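/- Let n ∈ ℕ and p ∈ [1,∞). Let Z_1,…,Z_n be independent random variables each with density f_p (p-generalized Gaussian), set Z = (Z_1,…,Z_n), and let U be uniform on [0,1] and independent of Z. Then: (i) Z/‖Z‖_p is distributed according to the cone probability measure μ_p^n on 𝕊_p^{n-1}; (ii) U^{1/n} · Z/‖Z‖_p is distributed according to the uniform probability measure ν_p^n on 𝔹_p^n; (iii) Z/‖Z‖_p is independent of ‖Z‖_p. -/

import Mathlib

open MeasureTheory Set
open scoped ENNReal

/-- The `p`-norm on `ℝ^n`. -/
noncomputable def pnorm {n : ℕ} (p : ℝ) (x : Fin n → ℝ) : ℝ :=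
  (∑ i, |x i| ^ p) ^ (1 / p)

/-- The unit ball `𝔹_p^n`. -/
def pBall (n : ℕ) (p : ℝ) : Set (Fin n → ℝ) := {x | pnorm p x ≤ 1}

/-- The unit sphere `𝕊_p^{n-1}`. -/
def pSphere (n : ℕ) (p : ℝ) : Set (Fin n → ℝ) := {x | pnorm p x = 1}

/-- The cone `[0,1]A = {r • a : r ∈ [0,1], a ∈ A}`. -/
def coneSet {n : ℕ} (A : Set (Fin n → ℝ)) : Set (Fin n → ℝ) :=
  Set.image2 (· • ·) (Icc (0 : ℝ) 1) A

/-- The `p`-generalized Gaussian density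
`f_p(x) = (2 p^{1/p} Γ(1+1/p))⁻¹ e^{-|x|^p/p}`. -/
noncomputable def pGaussianDensity (p : ℝ) (x : ℝ) : ℝ :=
  (2 * p ^ (1 / p) * Real.Gamma (1 + 1 / p))⁻¹ * Real.exp (-|x| ^ p / p)

lemma pnorm_nonneg {n : ℕ} (p : ℝ) (x : Fin n → ℝ) : 0 ≤ pnorm p x := by
  unfold pnorm
  positivity

lemma pnorm_smul {n : ℕ} {p : ℝ} (hp : 0 < p) {r : ℝ} (hr : 0 ≤ r) (x : Fin n → ℝ) :
    pnorm p (r • x) = r * pnorm p x := by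
  have h (i : Fin n) : |(r • x) i| ^ p = r ^ p * |x i| ^ p := by
    rw [Pi.smul_apply, smul_eq_mul, abs_mul, abs_of_nonneg hr, Real.mul_rpow hr (abs_nonneg _)]
  simp only [pnorm, h]
  rw [← Finset.mul_sum, Real.mul_rpow (by positivity) (by positivity), ← Real.rpow_mul hr,
    mul_one_div_cancel hp.ne', Real.rpow_one]

lemma pnorm_eq_zero {n : ℕ} {p : ℝ} (hp : 0 < p) {x : Fin n → ℝ} : pnorm p x = 0 ↔ x = 0 := by
  have hs : 0 ≤ ∑ i, |x i| ^ p := by positivity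
  rw [pnorm, Real.rpow_eq_zero hs (by positivity),
    Finset.sum_eq_zero_iff_of_nonneg (fun i _ => by positivity)]
  simp [Real.rpow_eq_zero (abs_nonneg _) hp.ne', funext_iff]

lemma pnorm_zero {n : ℕ} {p : ℝ} (hp : 0 < p) : pnorm p (0 : Fin n → ℝ) = 0 :=
  (pnorm_eq_zero hp).2 rfl

@[fun_prop]
lemma measurable_pnorm {n : ℕ} (p : ℝ) : Measurable (pnorm p : (Fin n → ℝ) → ℝ) := by
  unfold pnorm
  fun_prop

lemma measurableSet_pBall (n : ℕ) (p : ℝ) : MeasurableSet (pBall n p) :=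
  measurableSet_le (measurable_pnorm p) measurable_const

lemma volume_pnorm_le {n : ℕ} (hn : 1 ≤ n) {p : ℝ} (hp : 1 ≤ p) (r : ℝ) :
    volume {x : Fin n → ℝ | pnorm p x ≤ r} = ENNReal.ofReal r ^ n * volume (pBall n p) := by
  have : NeZero n := ⟨by omega⟩
  have h := volume_sum_rpow_le (Fin n) hp
  rw [Fintype.card_fin] at h
  change volume {x : Fin n → ℝ | (∑ i, |x i| ^ p) ^ (1 / p) ≤ r} =
    _ * volume {x : Fin n → ℝ | (∑ i, |x i| ^ p) ^ (1 / p) ≤ 1}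
  rw [h, h]
  simp

lemma volume_pBall_ne_zero {n : ℕ} (hn : 1 ≤ n) {p : ℝ} (hp : 1 ≤ p) :
    volume (pBall n p) ≠ 0 := by
  have : NeZero n := ⟨by omega⟩
  have hp0 : 0 < p := by linarith
  change volume {x : Fin n → ℝ | (∑ i, |x i| ^ p) ^ (1 / p) ≤ 1} ≠ 0
  have h₁ := Real.Gamma_pos_of_pos (show 0 < 1 / p + 1 by positivity)
  have h₂ := Real.Gamma_pos_of_pos (show 0 < (Fintype.card (Fin n) : ℝ) / p + 1 by positivity)
  rw [volume_sum_rpow_le (Fin n) hp, ENNReal.ofReal_one, one_pow, one_mul, ne_eq,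
    ENNReal.ofReal_eq_zero, not_le]
  positivity

lemma volume_pBall_ne_top {n : ℕ} (hn : 1 ≤ n) {p : ℝ} (hp : 1 ≤ p) :
    volume (pBall n p) ≠ ∞ := by
  have : NeZero n := ⟨by omega⟩
  change volume {x : Fin n → ℝ | (∑ i, |x i| ^ p) ^ (1 / p) ≤ 1} ≠ ∞
  rw [volume_sum_rpow_le (Fin n) hp, ENNReal.ofReal_one, one_pow, one_mul]
  exact ENNReal.ofReal_ne_top

/-- The projection `x ↦ x / ‖x‖_p` onto the unit sphere. -/
noncomputable def pDir {n : ℕ} (p : ℝ) (x : Fin n → ℝ) : Fin n → ℝ := (pnorm p x)⁻¹ • x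

@[fun_prop]
lemma measurable_pDir {n : ℕ} (p : ℝ) : Measurable (pDir p : (Fin n → ℝ) → _) := by
  unfold pDir
  fun_prop

lemma pnorm_smul_pDir {n : ℕ} {p : ℝ} (hp : 0 < p) (x : Fin n → ℝ) :
    pnorm p x • pDir p x = x := by
  by_cases h : pnorm p x = 0
  · rw [h, zero_smul, (pnorm_eq_zero hp).1 h]
  · rw [pDir, smul_inv_smul₀ h]

lemma pDir_smul {n : ℕ} {p : ℝ} (hp : 0 < p) {r : ℝ} (hr : 0 < r) (x : Fin n → ℝ) :
    pDir p (r • x) = pDir p x := by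
  rw [pDir, pDir, pnorm_smul hp hr.le, smul_smul, mul_inv, mul_right_comm,
    inv_mul_cancel₀ hr.ne', one_mul]

/-- The cone measure of a set of directions, extended to all sets by means of `pDir`. -/
noncomputable def coneWeight {n : ℕ} (p : ℝ) (A : Set (Fin n → ℝ)) : ℝ≥0∞ :=
  volume (pBall n p ∩ pDir p ⁻¹' A) / volume (pBall n p)

open scoped Pointwise in
lemma volume_sector {n : ℕ} (hn : 1 ≤ n) {p : ℝ} (hp : 1 ≤ p) (A : Set (Fin n → ℝ)) (r : ℝ) :
    volume ({x : Fin n → ℝ | pnorm p x ≤ r} ∩ pDir p ⁻¹' A) =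
      ENNReal.ofReal r ^ n * volume (pBall n p ∩ pDir p ⁻¹' A) := by
  have hp0 : 0 < p := by linarith
  rcases le_or_gt r 0 with hr | hr
  · have h0 : ENNReal.ofReal r ^ n = 0 := by
      rw [ENNReal.ofReal_of_nonpos hr, zero_pow (by omega)]
    rw [h0, zero_mul]
    refine measure_mono_null inter_subset_left ?_
    rw [volume_pnorm_le hn hp, h0, zero_mul]
  · have h : {x : Fin n → ℝ | pnorm p x ≤ r} ∩ pDir p ⁻¹' A =
        r • (pBall n p ∩ pDir p ⁻¹' A) := by
      ext x
      rw [mem_smul_set_iff_inv_smul_mem₀ hr.ne']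
      simp only [pBall, mem_inter_iff, mem_ofPred_eq, mem_preimage,
        pDir_smul hp0 (inv_pos.2 hr), pnorm_smul hp0 (inv_pos.2 hr).le]
      rw [inv_mul_le_iff₀ hr, mul_one]
    rw [h, Measure.addHaar_smul, Module.finrank_fin_fun, abs_of_nonneg (by positivity),
      ENNReal.ofReal_pow hr.le]

lemma map_pnorm_restrict_pDir {n : ℕ} (hn : 1 ≤ n) {p : ℝ} (hp : 1 ≤ p)
    (A : Set (Fin n → ℝ)) :
    (volume.restrict (pDir p ⁻¹' A)).map (pnorm p) =
      coneWeight p A • (volume : Measure (Fin n → ℝ)).map (pnorm p) := by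
  have hB0 := volume_pBall_ne_zero hn hp
  have hBt := volume_pBall_ne_top hn hp
  have hval (r : ℝ) : (volume.restrict (pDir p ⁻¹' A)).map (pnorm p) (Iic r) =
      ENNReal.ofReal r ^ n * volume (pBall n p ∩ pDir p ⁻¹' A) := by
    rw [Measure.map_apply (measurable_pnorm p) measurableSet_Iic,
      Measure.restrict_apply (measurable_pnorm p measurableSet_Iic)]
    exact volume_sector hn hp A r
  refine Measure.ext_of_generateFrom_of_iUnion (range Iic) (fun k : ℕ => Iic (k : ℝ))
    ((BorelSpace.measurable_eq).trans (borel_eq_generateFrom_Iic ℝ)) isPiSystem_Iic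
    (iUnion_Iic_of_not_bddAbove_range ?_) (fun k => ⟨_, rfl⟩) ?_ ?_
  · exact not_bddAbove_iff.2 fun x => by
      obtain ⟨k, hk⟩ := exists_nat_gt x
      exact ⟨k, ⟨k, rfl⟩, hk⟩
  · intro k
    rw [hval]
    exact ENNReal.mul_ne_top (ENNReal.pow_ne_top ENNReal.ofReal_ne_top)
      (measure_ne_top_of_subset inter_subset_left hBt)
  · rintro _ ⟨r, rfl⟩
    rw [hval, Measure.smul_apply, Measure.map_apply (measurable_pnorm p) measurableSet_Iic]
    change _ = _ • volume {x : Fin n → ℝ | pnorm p x ≤ r}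
    rw [volume_pnorm_le hn hp, smul_eq_mul, coneWeight, mul_left_comm,
      ENNReal.div_mul_cancel hB0 hBt]

section RadialDensity

variable {n : ℕ} {p : ℝ} {g : ℝ → ℝ≥0∞} {μ : Measure (Fin n → ℝ)}

lemma measure_pDir_inter_pnorm (hn : 1 ≤ n) (hp : 1 ≤ p) (hg : Measurable g)
    (hμ : μ = volume.withDensity fun x => g (pnorm p x))
    {A : Set (Fin n → ℝ)} (hA : MeasurableSet A) {B : Set ℝ} (hB : MeasurableSet B) :
    μ (pDir p ⁻¹' A ∩ pnorm p ⁻¹' B) = coneWeight p A * μ (pnorm p ⁻¹' B) := by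
  have hA' := measurable_pDir p hA
  have hB' := measurable_pnorm (n := n) p hB
  rw [hμ, withDensity_apply _ (hA'.inter hB'), withDensity_apply _ hB', inter_comm,
    ← Measure.restrict_restrict hB',
    ← setLIntegral_map hB hg (measurable_pnorm p), ← setLIntegral_map hB hg (measurable_pnorm p),
    map_pnorm_restrict_pDir hn hp A, Measure.restrict_smul, lintegral_smul_measure, smul_eq_mul]

lemma measure_pDir [IsProbabilityMeasure μ] (hn : 1 ≤ n) (hp : 1 ≤ p) (hg : Measurable g)
    (hμ : μ = volume.withDensity fun x => g (pnorm p x))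
    {A : Set (Fin n → ℝ)} (hA : MeasurableSet A) :
    μ (pDir p ⁻¹' A) = coneWeight p A := by
  simpa using measure_pDir_inter_pnorm hn hp hg hμ hA MeasurableSet.univ

lemma indepFun_pDir_pnorm [IsProbabilityMeasure μ] (hn : 1 ≤ n) (hp : 1 ≤ p) (hg : Measurable g)
    (hμ : μ = volume.withDensity fun x => g (pnorm p x)) :
    ProbabilityTheory.IndepFun (pDir p) (pnorm p) μ := by
  rw [ProbabilityTheory.indepFun_iff_measure_inter_preimage_eq_mul]
  intro A B hA hB
  rw [measure_pDir_inter_pnorm hn hp hg hμ hA hB, measure_pDir hn hp hg hμ hA]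

end RadialDensity

/-- The uniform distribution on `𝔹_p^n`. -/
noncomputable def pBallUniform (n : ℕ) (p : ℝ) : Measure (Fin n → ℝ) :=
  volume.withDensity fun x => (Iic (1 : ℝ)).indicator (fun _ => (volume (pBall n p))⁻¹) (pnorm p x)

lemma pBallUniform_apply (n : ℕ) (p : ℝ) {A : Set (Fin n → ℝ)} (hA : MeasurableSet A) :
    pBallUniform n p A = volume (A ∩ pBall n p) / volume (pBall n p) := by
  have h : (fun x : Fin n → ℝ => (Iic (1 : ℝ)).indicator
      (fun _ => (volume (pBall n p))⁻¹) (pnorm p x)) =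
      (pBall n p).indicator fun _ => (volume (pBall n p))⁻¹ := rfl
  rw [pBallUniform, h, withDensity_indicator (measurableSet_pBall n p),
    withDensity_apply _ hA, setLIntegral_const, Measure.restrict_apply hA, mul_comm,
    ENNReal.div_eq_inv_mul, mul_comm]

lemma isProbabilityMeasure_pBallUniform {n : ℕ} (hn : 1 ≤ n) {p : ℝ} (hp : 1 ≤ p) :
    IsProbabilityMeasure (pBallUniform n p) :=
  ⟨by rw [pBallUniform_apply n p MeasurableSet.univ, univ_inter,
    ENNReal.div_self (volume_pBall_ne_zero hn hp) (volume_pBall_ne_top hn hp)]⟩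

lemma pBallUniform_pnorm_le {n : ℕ} (hn : 1 ≤ n) {p : ℝ} (hp : 1 ≤ p) (r : ℝ) :
    pBallUniform n p (pnorm p ⁻¹' Iic r) = ENNReal.ofReal (min r 1) ^ n := by
  have h : pnorm p ⁻¹' Iic r ∩ pBall n p = {x | pnorm p x ≤ min r 1} := by
    ext x
    simp [pBall]
  rw [pBallUniform_apply n p (measurable_pnorm p measurableSet_Iic), h, volume_pnorm_le hn hp,
    ENNReal.mul_div_cancel_right (volume_pBall_ne_zero hn hp) (volume_pBall_ne_top hn hp)]

lemma volume_rpow_inv_le {n : ℕ} (hn : 1 ≤ n) (r : ℝ) :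
    volume ({u : ℝ | u ^ ((n : ℝ)⁻¹) ≤ r} ∩ Icc 0 1) = ENNReal.ofReal (min r 1) ^ n := by
  have hn0 : (0 : ℝ) < n := by exact_mod_cast hn
  rcases lt_or_ge r 0 with hr | hr
  · have h : {u : ℝ | u ^ ((n : ℝ)⁻¹) ≤ r} ∩ Icc 0 1 = ∅ := by
      ext u
      simp only [mem_inter_iff, mem_ofPred_eq, mem_Icc, mem_empty_iff_false, iff_false]
      rintro ⟨h₁, h₂, -⟩
      linarith [Real.rpow_nonneg h₂ ((n : ℝ)⁻¹)]
    rw [h, measure_empty, ENNReal.ofReal_of_nonpos ((min_le_left _ _).trans hr.le),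
      zero_pow (by omega)]
  · have hm : 0 ≤ min r 1 := le_min hr zero_le_one
    have h : {u : ℝ | u ^ ((n : ℝ)⁻¹) ≤ r} ∩ Icc 0 1 = Icc 0 (min r 1 ^ n) := by
      ext u
      simp only [mem_inter_iff, mem_ofPred_eq, mem_Icc]
      constructor
      · rintro ⟨h₁, h₂, h₃⟩
        refine ⟨h₂, ?_⟩
        rw [← Real.rpow_natCast, ← Real.rpow_inv_le_iff_of_pos h₂ hm hn0]
        exact le_min h₁ (Real.rpow_le_one h₂ h₃ (by positivity))
      · rintro ⟨h₂, h₃⟩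
        refine ⟨?_, h₂, h₃.trans (pow_le_one₀ hm (min_le_right _ _))⟩
        rw [← Real.rpow_natCast, ← Real.rpow_inv_le_iff_of_pos h₂ hm hn0] at h₃
        exact h₃.trans (min_le_left _ _)
    rw [h, Real.volume_Icc, sub_zero, ENNReal.ofReal_pow hm]

lemma volume_coneSet {n : ℕ} (hn : 1 ≤ n) {p : ℝ} (hp : 1 ≤ p) {A : Set (Fin n → ℝ)}
    (hA : A ⊆ pSphere n p) :
    volume (coneSet A) = volume (pBall n p ∩ pDir p ⁻¹' A) := by
  have hp0 : 0 < p := by linarith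
  have : NeZero n := ⟨by omega⟩
  have hne {x : Fin n → ℝ} (hx : pDir p x ∈ A) : pnorm p x ≠ 0 := by
    intro h
    have h₁ : pnorm p (pDir p x) = 1 := hA hx
    rw [pDir, h, inv_zero, zero_smul, pnorm_zero hp0] at h₁
    exact zero_ne_one h₁
  have h : pBall n p ∩ pDir p ⁻¹' A = coneSet A \ {0} := by
    ext x
    constructor
    · rintro ⟨hx, hxA⟩
      refine ⟨⟨pnorm p x, ⟨pnorm_nonneg p x, hx⟩, pDir p x, hxA, pnorm_smul_pDir hp0 x⟩, ?_⟩
      rintro rfl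
      exact hne hxA (pnorm_zero hp0)
    · rintro ⟨⟨r, ⟨hr₀, hr₁⟩, a, ha, rfl⟩, h0⟩
      have hr : 0 < r := hr₀.lt_of_ne fun h => h0 (by simp [← h])
      have ha₁ : pnorm p a = 1 := hA ha
      constructor
      · change pnorm p (r • a) ≤ 1
        rwa [pnorm_smul hp0 hr₀, ha₁, mul_one]
      · change pDir p (r • a) ∈ A
        rwa [pDir_smul hp0 hr, pDir, ha₁, inv_one, one_smul]
  rw [h, measure_sdiff_null (measure_singleton _)]

lemma lintegral_fin_nat_prod_eq_prod {n : ℕ} {E : Type*} [MeasurableSpace E]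
    (μ : Fin n → Measure E) [∀ i, SigmaFinite (μ i)] {f : E → ℝ≥0∞} (hf : Measurable f) :
    ∫⁻ x, ∏ i, f (x i) ∂(Measure.pi μ) = ∏ i, ∫⁻ x, f x ∂(μ i) := by
  induction n with
  | zero => simp
  | succ n ih =>
    rw [← ((measurePreserving_piFinSuccAbove μ 0).symm).lintegral_comp_emb
      (MeasurableEquiv.measurableEmbedding _)]
    simp_rw [MeasurableEquiv.piFinSuccAbove_symm_apply, Fin.insertNthEquiv,
      Fin.prod_univ_succ, Fin.insertNth_zero, Equiv.coe_fn_mk, Fin.cons_succ,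
      Fin.zero_succAbove, Fin.cons_zero]
    rw [← ih]
    have hm : Measurable fun x : Fin n → E => ∏ i, f (x i) :=
      Finset.measurable_fun_prod _ fun i _ => hf.comp (measurable_pi_apply i)
    exact lintegral_prod_mul hf.aemeasurable hm.aemeasurable

lemma pi_withDensity {n : ℕ} {E : Type*} [MeasurableSpace E] (μ : Measure E) [SigmaFinite μ]
    {f : E → ℝ≥0∞} (hf : Measurable f) [SigmaFinite (μ.withDensity f)] :
    Measure.pi (fun _ : Fin n => μ.withDensity f) =
      (Measure.pi fun _ : Fin n => μ).withDensity fun x => ∏ i, f (x i) := by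
  refine Measure.pi_eq fun s hs => ?_
  rw [withDensity_apply _ (MeasurableSet.univ_pi hs), Measure.restrict_pi_pi,
    lintegral_fin_nat_prod_eq_prod _ hf]
  simp_rw [withDensity_apply _ (hs _)]

lemma prod_pGaussianDensity {n : ℕ} {p : ℝ} (hp : 1 ≤ p) (x : Fin n → ℝ) :
    ∏ i, ENNReal.ofReal (pGaussianDensity p (x i)) =
      ENNReal.ofReal ((2 * p ^ (1 / p) * Real.Gamma (1 + 1 / p))⁻¹ ^ n *
        Real.exp (-pnorm p x ^ p / p)) := by
  have hp0 : 0 < p := by linarith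
  have hΓ := Real.Gamma_pos_of_pos (show 0 < 1 + 1 / p by positivity)
  have hN : pnorm p x ^ p = ∑ i, |x i| ^ p := by
    rw [pnorm, ← Real.rpow_mul (by positivity), one_div_mul_cancel hp0.ne', Real.rpow_one]
  unfold pGaussianDensity
  rw [← ENNReal.ofReal_prod_of_nonneg fun i _ => by positivity, Finset.prod_mul_distrib,
    Finset.prod_const, Finset.card_univ, Fintype.card_fin, ← Real.exp_sum, hN,
    ← Finset.sum_div, Finset.sum_neg_distrib]

/-- Schechtman–Zinn probabilistic representation of the cone and uniform measures on
`𝔹_p^n`. If `Z = (Z_1,…,Z_n)` has independent coordinates distributed with density `f_p`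
and `U` is uniform on `[0,1]` and independent of `Z`, then `Z/‖Z‖_p` follows the cone
probability measure `μ_p^n` on `𝕊_p^{n-1}`, `U^{1/n} Z/‖Z‖_p` follows the uniform
probability measure `ν_p^n` on `𝔹_p^n`, and `Z/‖Z‖_p` is independent of `‖Z‖_p`. -/
theorem schechtman_zinn_representation
    (n : ℕ) (hn : 1 ≤ n) (p : ℝ) (hp : 1 ≤ p)
    {Ω : Type*} [MeasurableSpace Ω] (P : Measure Ω) [IsProbabilityMeasure P]
    (Z : Ω → (Fin n → ℝ)) (U : Ω → ℝ) (hZ : Measurable Z) (hU : Measurable U)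
    -- the coordinates of `Z` are independent with density `f_p`:
    (hZlaw : Measure.map Z P =
      Measure.pi (fun _ : Fin n => volume.withDensity
        (fun x => ENNReal.ofReal (pGaussianDensity p x))))
    -- `U` is uniform on `[0,1]`:
    (hUlaw : Measure.map U P = volume.restrict (Icc (0 : ℝ) 1))
    -- `U` and `Z` are independent:
    (hindep : ProbabilityTheory.IndepFun U Z P) :
    -- (i) `Z/‖Z‖_p` is distributed according to the cone measure `μ_p^n`:
    (∀ A : Set (Fin n → ℝ), MeasurableSet A → A ⊆ pSphere n p →
      P {ω | (pnorm p (Z ω))⁻¹ • Z ω ∈ A} = volume (coneSet A) / volume (pBall n p)) ∧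
    -- (ii) `U^{1/n} ⬝ Z/‖Z‖_p` is distributed according to the uniform measure `ν_p^n`:
    (∀ A : Set (Fin n → ℝ), MeasurableSet A →
      P {ω | (U ω ^ ((n : ℝ)⁻¹)) • (pnorm p (Z ω))⁻¹ • Z ω ∈ A} =
        volume (A ∩ pBall n p) / volume (pBall n p)) ∧
    -- (iii) `Z/‖Z‖_p` is independent of `‖Z‖_p`:
    ProbabilityTheory.IndepFun (fun ω => (pnorm p (Z ω))⁻¹ • Z ω)
      (fun ω => pnorm p (Z ω)) P := by
  have hp0 : 0 < p := by linarith
  have hZr : P.map Z = volume.withDensity fun x => (fun t : ℝ => ENNReal.ofReal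
      ((2 * p ^ (1 / p) * Real.Gamma (1 + 1 / p))⁻¹ ^ n * Real.exp (-t ^ p / p))) (pnorm p x) := by
    have hm : Measurable fun x => ENNReal.ofReal (pGaussianDensity p x) := by
      unfold pGaussianDensity
      fun_prop
    rw [hZlaw, pi_withDensity volume hm]
    simp_rw [prod_pGaussianDensity hp]
    rfl
  have hg : Measurable fun t : ℝ => ENNReal.ofReal
      ((2 * p ^ (1 / p) * Real.Gamma (1 + 1 / p))⁻¹ ^ n * Real.exp (-t ^ p / p)) := by
    fun_prop
  have := Measure.isProbabilityMeasure_map (μ := P) hZ.aemeasurable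
  have hdir {A : Set (Fin n → ℝ)} (hA : MeasurableSet A) :
      P ((fun ω => pDir p (Z ω)) ⁻¹' A) = coneWeight p A := by
    rw [← measure_pDir hn hp hg hZr hA, Measure.map_apply hZ (measurable_pDir p hA)]
    rfl
  refine ⟨fun A hA hAs => ?_, fun A hA => ?_, ?_⟩
  · rw [volume_coneSet hn hp hAs]
    exact hdir hA
  · have := isProbabilityMeasure_pBallUniform hn hp
    have hh : Measurable ((Iic (1 : ℝ)).indicator fun _ => (volume (pBall n p))⁻¹) :=
      measurable_const.indicator measurableSet_Iic
    have hθ : P.map (fun ω => pDir p (Z ω)) = (pBallUniform n p).map (pDir p) := by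
      ext A hA
      rw [Measure.map_apply (by fun_prop) hA, Measure.map_apply (by fun_prop) hA, hdir hA,
        measure_pDir (μ := pBallUniform n p) hn hp hh rfl hA]
    have hV : Measurable fun ω => U ω ^ ((n : ℝ)⁻¹) := by fun_prop
    have hR : P.map (fun ω => U ω ^ ((n : ℝ)⁻¹)) = (pBallUniform n p).map (pnorm p) := by
      have := Measure.isProbabilityMeasure_map (μ := P) hV.aemeasurable
      refine Measure.ext_of_Iic _ _ fun r => ?_
      have hm : MeasurableSet {u : ℝ | u ^ ((n : ℝ)⁻¹) ≤ r} :=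
        measurableSet_le (by fun_prop) measurable_const
      rw [Measure.map_apply (by fun_prop) measurableSet_Iic,
        Measure.map_apply (by fun_prop) measurableSet_Iic, pBallUniform_pnorm_le hn hp,
        ← volume_rpow_inv_le hn, ← Measure.restrict_apply hm, ← hUlaw, Measure.map_apply hU hm]
      rfl
    have hjoint : P.map (fun ω => (pDir p (Z ω), U ω ^ ((n : ℝ)⁻¹))) =
        (pBallUniform n p).map fun x => (pDir p x, pnorm p x) := by
      have hi : ProbabilityTheory.IndepFun (fun ω => pDir p (Z ω))
          (fun ω => U ω ^ ((n : ℝ)⁻¹)) P :=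
        hindep.symm.comp (φ := pDir p) (ψ := fun u => u ^ ((n : ℝ)⁻¹)) (by fun_prop)
          (by fun_prop)
      rw [hi.map_prod_eq_prod_map_map (by fun_prop) (by fun_prop),
        (indepFun_pDir_pnorm (μ := pBallUniform n p) hn hp hh rfl).map_prod_eq_prod_map_map (by fun_prop) (by fun_prop),
        hθ, hR]
    have hs : MeasurableSet ((fun z : (Fin n → ℝ) × ℝ => z.2 • z.1) ⁻¹' A) :=
      (show Measurable fun z : (Fin n → ℝ) × ℝ => z.2 • z.1 by fun_prop) hA
    rw [← pBallUniform_apply n p hA]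
    calc P {ω | (U ω ^ ((n : ℝ)⁻¹)) • (pnorm p (Z ω))⁻¹ • Z ω ∈ A}
        = P.map (fun ω => (pDir p (Z ω), U ω ^ ((n : ℝ)⁻¹)))
            ((fun z : (Fin n → ℝ) × ℝ => z.2 • z.1) ⁻¹' A) := by
          rw [Measure.map_apply (by fun_prop) hs]
          rfl
      _ = pBallUniform n p A := by
          rw [hjoint, Measure.map_apply (by fun_prop) hs]
          congr 1
          ext x
          simp only [mem_preimage, pnorm_smul_pDir hp0]
  · have h := indepFun_pDir_pnorm hn hp hg hZr
    rw [ProbabilityTheory.indepFun_iff_measure_inter_preimage_eq_mul] at h ⊢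
    intro A B hA hB
    have h' := h A B hA hB
    have hA' := measurable_pDir p hA
    have hB' := measurable_pnorm (n := n) p hB
    rwa [Measure.map_apply hZ (hA'.inter hB'), Measure.map_apply hZ hA',
      Measure.map_apply hZ hB'] at h'
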